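/- Let ζ₁, …, ζₙ, ζₙ₊₁ be discrete random variables on a common probability space taking values in finite sets, let {k}, I, J be pairwise disjoint subsets of {1, …, n}, and suppose (a) the joint distribution of (ζₙ₊₁, ζ_I) equals the joint distribution of (ζ_k, ζ_I), and (b) ζₙ₊₁ is conditionally independent of ζ_{{k} ∪ J} given ζ_I. Then the joint Shannon entropies satisfy: H({n+1} ∪ I₁) = H({k} ∪ I₁) for every I₁ ⊆ I, and H({n+1} ∪ I) + H(I ∪ J₁) = H({n+1} ∪ I ∪ J₁) + H(I) for every nonempty J₁ ⊆ {k} ∪ J. -/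

import Mathlib

open MeasureTheory

/-- The Shannon entropy of a random variable `X` taking values in a finite set,
computed from the distribution of `X` under the measure `μ`. -/
noncomputable def shannonEntropy {Ω : Type*} [MeasurableSpace Ω] (μ : Measure Ω)
    {β : Type*} [Fintype β] (X : Ω → β) : ℝ :=
  ∑ b : β, Real.negMulLog ((μ (X ⁻¹' {b})).toReal)

/-- The mass of a fibre of `g ∘ Z` inside `A` is the sum of the masses of the fibres of `Z`. -/
theorem measureReal_preimage_comp_inter {Ω β γ : Type*} [MeasurableSpace Ω] (μ : Measure Ω)
    [IsFiniteMeasure μ] [Fintype β] [MeasurableSpace β] [MeasurableSingletonClass β]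
    [DecidableEq γ] {Z : Ω → β} (hZ : Measurable Z) (g : β → γ) (c : γ) (A : Set Ω) :
    μ.real ((fun ω => g (Z ω)) ⁻¹' {c} ∩ A)
      = ∑ z with g z = c, μ.real (Z ⁻¹' {z} ∩ A) := by
  have h := sum_measureReal_preimage_singleton (μ := μ.restrict A)
    (Finset.univ.filter fun z => g z = c) (f := Z)
    (fun z _ => hZ (measurableSet_singleton z))
  have hset : Z ⁻¹' (↑(Finset.univ.filter fun z => g z = c) : Set β)
      = (fun ω => g (Z ω)) ⁻¹' {c} := by
    ext ω; simp
  have hmeas : MeasurableSet ((fun ω => g (Z ω)) ⁻¹' {c}) := by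
    rw [← hset]
    exact hZ (Finset.measurableSet _)
  rw [hset, measureReal_restrict_apply hmeas] at h
  rw [← h]
  exact Finset.sum_congr rfl fun z _ =>
    measureReal_restrict_apply (hZ (measurableSet_singleton z))

/-- The entropy of a function of `X`, as an average over the values of `X`. -/
theorem shannonEntropy_comp {Ω β γ : Type*} [MeasurableSpace Ω] (μ : Measure Ω)
    [IsFiniteMeasure μ] [Fintype β] [MeasurableSpace β] [MeasurableSingletonClass β] [Fintype γ]
    {X : Ω → β} (hX : Measurable X) (f : β → γ) :
    shannonEntropy μ (fun ω => f (X ω))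
      = -∑ b, μ.real (X ⁻¹' {b}) * Real.log (μ.real ((fun ω => f (X ω)) ⁻¹' {f b})) := by
  classical
  rw [← Finset.sum_fiberwise Finset.univ f, shannonEntropy, ← Finset.sum_neg_distrib]
  refine Finset.sum_congr rfl fun c _ => ?_
  have h := measureReal_preimage_comp_inter μ hX f c Set.univ
  simp only [Set.inter_univ] at h
  rw [Finset.sum_congr rfl (g := fun b => μ.real (X ⁻¹' {b}) *
    Real.log (μ.real ((fun ω => f (X ω)) ⁻¹' {c}))), ← Finset.sum_mul, ← h]
  · simp [Real.negMulLog, Measure.real]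
  · intro b hb
    rw [(Finset.mem_filter.1 hb).2]

/-- Entropy depends only on the distribution. -/
theorem shannonEntropy_congr_map {Ω β : Type*} [MeasurableSpace Ω] (μ : Measure Ω)
    [Fintype β] [MeasurableSpace β] [MeasurableSingletonClass β]
    {X Y : Ω → β} (hX : Measurable X) (hY : Measurable Y) (h : μ.map X = μ.map Y) :
    shannonEntropy μ X = shannonEntropy μ Y := by
  refine Finset.sum_congr rfl fun b _ => ?_
  rw [← Measure.map_apply hX (measurableSet_singleton b), h,
    Measure.map_apply hY (measurableSet_singleton b)]

/-- If `Y` and `g ∘ V` are conditionally independent given `h ∘ V`, and `V` is determined by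
`g ∘ V` and `h ∘ V`, then the submodularity inequality of entropy is an equality. -/
theorem shannonEntropy_add_eq_of_condIndep {Ω β γ δ ε : Type*} [MeasurableSpace Ω]
    (μ : Measure Ω) [IsFiniteMeasure μ]
    [Fintype β] [MeasurableSpace β] [MeasurableSingletonClass β]
    [Fintype γ] [MeasurableSpace γ] [MeasurableSingletonClass γ] [Fintype ε]
    {Y : Ω → β} {V : Ω → γ} (hY : Measurable Y) (hV : Measurable V) (g : γ → δ) (h : γ → ε)
    (hinj : Function.Injective fun v => (g v, h v))
    (hci : ∀ y z w, μ.real {ω | Y ω = y ∧ g (V ω) = z ∧ h (V ω) = w} * μ.real {ω | h (V ω) = w}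
      = μ.real {ω | Y ω = y ∧ h (V ω) = w} * μ.real {ω | g (V ω) = z ∧ h (V ω) = w}) :
    shannonEntropy μ (fun ω => (Y ω, h (V ω))) + shannonEntropy μ V
      = shannonEntropy μ (fun ω => (Y ω, V ω)) + shannonEntropy μ (fun ω => h (V ω)) := by
  have hX : Measurable fun ω => (Y ω, V ω) := hY.prodMk hV
  have e₁ := shannonEntropy_comp μ hX fun x => (x.1, h x.2)
  have e₂ := shannonEntropy_comp μ hX fun x => x.2
  have e₃ := shannonEntropy_comp μ hX fun x => x
  have e₄ := shannonEntropy_comp μ hX fun x => h x.2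
  rw [e₁, e₃, e₄, show shannonEntropy μ V = _ from e₂, ← neg_add, ← neg_add,
    ← Finset.sum_add_distrib, ← Finset.sum_add_distrib]
  congr 1
  refine Finset.sum_congr rfl fun ⟨y, v⟩ _ => ?_
  have hv : ∀ ω, V ω = v ↔ g (V ω) = g v ∧ h (V ω) = h v := fun ω => by
    rw [← Prod.mk_inj]
    exact hinj.eq_iff.symm
  have s₁ : (fun ω => (Y ω, h (V ω))) ⁻¹' {(y, h v)} = {ω | Y ω = y ∧ h (V ω) = h v} := by
    ext ω; simp
  have s₂ : V ⁻¹' {v} = {ω | g (V ω) = g v ∧ h (V ω) = h v} := by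
    ext ω; simp [hv]
  have s₃ : (fun ω => (Y ω, V ω)) ⁻¹' {(y, v)}
      = {ω | Y ω = y ∧ g (V ω) = g v ∧ h (V ω) = h v} := by
    ext ω; simp [hv]
  have s₄ : (fun ω => h (V ω)) ⁻¹' {h v} = {ω | h (V ω) = h v} := rfl
  simp only [s₁, s₂, s₃, s₄]
  have key := hci y (g v) (h v)
  rcases eq_or_ne (μ.real {ω | Y ω = y ∧ g (V ω) = g v ∧ h (V ω) = h v}) 0 with h0 | h0
  · simp [h0]
  have pos : ∀ s : Set Ω, {ω | Y ω = y ∧ g (V ω) = g v ∧ h (V ω) = h v} ⊆ s → μ.real s ≠ 0 :=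
    fun s hs hs0 => h0 (le_antisymm (hs0 ▸ measureReal_mono hs) measureReal_nonneg)
  rw [← mul_add, ← mul_add, ← Real.log_mul, ← Real.log_mul, key]
  · exact h0
  · exact pos _ fun ω hω => hω.2.2
  · exact pos _ fun ω hω => ⟨hω.1, hω.2.2⟩
  · exact pos _ fun ω hω => hω.2

/-- Conditional independence of `Y` and `Z` given `W` passes to functions of `Z`. -/
theorem measureReal_mul_eq_of_condIndep_comp {Ω β γ δ ε : Type*} [MeasurableSpace Ω]
    (μ : Measure Ω) [IsFiniteMeasure μ]
    [Fintype γ] [MeasurableSpace γ] [MeasurableSingletonClass γ]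
    {Y : Ω → β} {Z : Ω → γ} {W : Ω → ε} (hZ : Measurable Z) (g : γ → δ)
    (hci : ∀ y z w, μ {ω | W ω = w} ≠ 0 →
      μ {ω | Y ω = y ∧ Z ω = z ∧ W ω = w} * μ {ω | W ω = w}
        = μ {ω | Y ω = y ∧ W ω = w} * μ {ω | Z ω = z ∧ W ω = w}) (y : β) (c : δ) (w : ε) :
    μ.real {ω | Y ω = y ∧ g (Z ω) = c ∧ W ω = w} * μ.real {ω | W ω = w}
      = μ.real {ω | Y ω = y ∧ W ω = w} * μ.real {ω | g (Z ω) = c ∧ W ω = w} := by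
  classical
  by_cases hw : μ {ω | W ω = w} = 0
  · have h0 : μ {ω | Y ω = y ∧ W ω = w} = 0 := measure_mono_null (fun ω hω => hω.2) hw
    simp [Measure.real, hw, h0]
  have e₁ : {ω | Y ω = y ∧ g (Z ω) = c ∧ W ω = w}
      = (fun ω => g (Z ω)) ⁻¹' {c} ∩ {ω | Y ω = y ∧ W ω = w} := by
    ext ω; simp; tauto
  have e₂ : {ω | g (Z ω) = c ∧ W ω = w} = (fun ω => g (Z ω)) ⁻¹' {c} ∩ {ω | W ω = w} := rfl
  rw [e₁, e₂, measureReal_preimage_comp_inter μ hZ, measureReal_preimage_comp_inter μ hZ,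
    Finset.sum_mul, Finset.mul_sum]
  refine Finset.sum_congr rfl fun z _ => ?_
  have e₃ : Z ⁻¹' {z} ∩ {ω | Y ω = y ∧ W ω = w} = {ω | Y ω = y ∧ Z ω = z ∧ W ω = w} := by
    ext ω; simp; tauto
  have e₄ : Z ⁻¹' {z} ∩ {ω | W ω = w} = {ω | Z ω = z ∧ W ω = w} := rfl
  rw [e₃, e₄]
  simpa [Measure.real] using congrArg ENNReal.toReal (hci y z w hw)

/-- If `ζ'` (playing the role of `ζₙ₊₁`) satisfies (a) `(ζ', ζ_I)` is distributed as
`(ζ_k, ζ_I)` and (b) `ζ'` is conditionally independent of `ζ_{{k} ∪ J}` given `ζ_I`,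
where `{k}, I, J ⊆ {1, …, n}` are pairwise disjoint, then the joint entropies satisfy
`H({n+1} ∪ I₁) = H({k} ∪ I₁)` for all `I₁ ⊆ I`, and
`H({n+1} ∪ I) + H(I ∪ J₁) = H({n+1} ∪ I ∪ J₁) + H(I)` for all nonempty `J₁ ⊆ {k} ∪ J`. -/
theorem copy_entropy_equalities {n : ℕ} {Ω : Type*} [MeasurableSpace Ω] (μ : Measure Ω)
    [IsProbabilityMeasure μ]
    (α : Fin n → Type) [∀ i, Fintype (α i)] [∀ i, MeasurableSpace (α i)]
    [∀ i, DiscreteMeasurableSpace (α i)]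
    (ζ : ∀ i, Ω → α i) (hζ : ∀ i, Measurable (ζ i))
    (k : Fin n) (I J : Finset (Fin n)) (hkI : k ∉ I) (hkJ : k ∉ J) (hIJ : Disjoint I J)
    (ζ' : Ω → α k) (hζ' : Measurable ζ')
    -- (a) the joint distribution of (ζₙ₊₁, ζ_I) equals that of (ζ_k, ζ_I)
    (hdist : μ.map (fun ω => (ζ' ω, fun i : I => ζ i.1 ω))
      = μ.map (fun ω => (ζ k ω, fun i : I => ζ i.1 ω)))
    -- (b) ζₙ₊₁ is conditionally independent of ζ_{{k} ∪ J} given ζ_I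
    (hci : ∀ (y : α k) (z : ∀ i : ({k} ∪ J : Finset (Fin n)), α i.1) (w : ∀ i : I, α i.1),
      μ {ω | (fun i : I => ζ i.1 ω) = w} ≠ 0 →
      μ {ω | ζ' ω = y ∧ (fun i : ({k} ∪ J : Finset (Fin n)) => ζ i.1 ω) = z
            ∧ (fun i : I => ζ i.1 ω) = w}
          * μ {ω | (fun i : I => ζ i.1 ω) = w}
        = μ {ω | ζ' ω = y ∧ (fun i : I => ζ i.1 ω) = w}
          * μ {ω | (fun i : ({k} ∪ J : Finset (Fin n)) => ζ i.1 ω) = z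
                 ∧ (fun i : I => ζ i.1 ω) = w}) :
    -- H({n+1} ∪ I₁) = H({k} ∪ I₁) for every I₁ ⊆ I
    (∀ I₁ : Finset (Fin n), I₁ ⊆ I →
      shannonEntropy μ (fun ω => (ζ' ω, fun i : I₁ => ζ i.1 ω))
        = shannonEntropy μ (fun ω => (ζ k ω, fun i : I₁ => ζ i.1 ω))) ∧
    -- H({n+1} ∪ I) + H(I ∪ J₁) = H({n+1} ∪ I ∪ J₁) + H(I) for every nonempty J₁ ⊆ {k} ∪ J
    (∀ J₁ : Finset (Fin n), J₁ ⊆ {k} ∪ J → J₁ ≠ ∅ →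
      shannonEntropy μ (fun ω => (ζ' ω, fun i : I => ζ i.1 ω))
          + shannonEntropy μ (fun ω => fun i : (I ∪ J₁ : Finset (Fin n)) => ζ i.1 ω)
        = shannonEntropy μ (fun ω => (ζ' ω, fun i : (I ∪ J₁ : Finset (Fin n)) => ζ i.1 ω))
          + shannonEntropy μ (fun ω => fun i : I => ζ i.1 ω)) := by
  have hsub : ∀ S : Finset (Fin n), Measurable fun ω => fun i : S => ζ i.1 ω :=
    fun S => measurable_pi_lambda _ fun i => hζ i.1
  refine ⟨fun I₁ hI₁ => ?_, fun J₁ hJ₁ _ => ?_⟩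
  · refine shannonEntropy_congr_map μ (hζ'.prodMk (hsub I₁)) ((hζ k).prodMk (hsub I₁)) ?_
    have hr : Measurable fun x : α k × (∀ i : I, α i.1) =>
        (x.1, fun i : I₁ => x.2 ⟨i.1, hI₁ i.2⟩) := by
      fun_prop
    have h := congrArg (Measure.map fun x : α k × (∀ i : I, α i.1) =>
        (x.1, fun i : I₁ => x.2 ⟨i.1, hI₁ i.2⟩)) hdist
    rwa [Measure.map_map hr (hζ'.prodMk (hsub I)),
      Measure.map_map hr ((hζ k).prodMk (hsub I))] at h
  · refine shannonEntropy_add_eq_of_condIndep μ hζ' (hsub (I ∪ J₁))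
      (fun v (i : J₁) => v ⟨i.1, Finset.mem_union_right I i.2⟩)
      (fun v (i : I) => v ⟨i.1, Finset.mem_union_left J₁ i.2⟩) ?_ ?_
    · intro v v' hvv'
      obtain ⟨hg, hh⟩ := Prod.mk_inj.1 hvv'
      funext ⟨i, hi⟩
      rcases Finset.mem_union.1 hi with hi' | hi'
      · exact congrFun hh ⟨i, hi'⟩
      · exact congrFun hg ⟨i, hi'⟩
    · exact measureReal_mul_eq_of_condIndep_comp μ (hsub ({k} ∪ J))
        (fun z (i : J₁) => z ⟨i.1, hJ₁ i.2⟩) hci
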